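/- arXiv:0906.0447 — 3 statements merged into one kernel-verified Lean document; each statement's English description precedes it below -/
import Mathlib

section
/- Theorem (Debreu–Fan–Glicksberg, 1952). Let G = (K, {S_i}, {u_i}) be a strategic-form game with a finite set of players K = {1,...,K} such that for every player i the strategy set S_i is a nonempty, compact and convex subset of a finite-dimensional real vector space ℝ^{n_i}, and the utility function u_i : S_1 × ... × S_K → ℝ is continuous in the full strategy profile and quasi-concave in the player's own strategy s_i (for every fixed profile s_{-i} of the other players). Then G possesses at least one pure-strategy Nash equilibrium, i.e., a profile s* such that for every player i and every s_i' ∈ S_i, u_i(s_i*, s_{-i}*) ≥ u_i(s_i', s_{-i}*). -/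
/-- `σ` is dominant for the rankings `r i` when no point lies strictly above the `r i`-minimum
of `σ` for every `i` simultaneously. -/
def IsDominant {W I α : Type*} [LinearOrder α] (r : I → W → α) (σ : Finset W) : Prop :=
  ∀ y, ∃ i, ∀ x ∈ σ, r i y ≤ r i x

theorem IsDominant.mono {W I α : Type*} [LinearOrder α] {r : I → W → α} {σ τ : Finset W}
    (h : IsDominant r σ) (hτ : τ ⊆ σ) : IsDominant r τ := fun y =>
  (h y).imp fun _ hi x hx => hi x (hτ hx)

/-- A surjection from a type with one more element than the finset `τ` onto `τ` identifies
exactly one pair. -/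
theorem exists_unique_pair_of_surjective {W I : Type*} [Fintype I] [DecidableEq W]
    {τ : Finset W} {m : I → W} (hcard : τ.card + 1 = Fintype.card I) (hmem : ∀ i, m i ∈ τ)
    (hsurj : ∀ x ∈ τ, ∃ i, m i = x) :
    ∃ a b, a ≠ b ∧ m a = m b ∧ (∀ i j, i ≠ a → j ≠ a → m i = m j → i = j) ∧
      (∀ i j, i ≠ b → j ≠ b → m i = m j → i = j) := by
  classical
  obtain ⟨a, -, b, -, hab, hm⟩ := Finset.exists_ne_map_eq_of_card_lt_of_maps_to
    (s := (Finset.univ : Finset I)) (t := τ) (f := m) (by rw [Finset.card_univ]; omega)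
    (fun i _ => hmem i)
  have key : ∀ a b, a ≠ b → m a = m b → ∀ i j, i ≠ a → j ≠ a → m i = m j → i = j := by
    intro a b hab hm
    have hinj := Finset.injOn_of_surjOn_of_card_le (s := Finset.univ.erase a) (t := τ) m
      (fun i _ => hmem i)
      (by
        intro x hx
        obtain ⟨i, rfl⟩ := hsurj x hx
        by_cases hi : i = a
        · exact ⟨b, by simp [hab.symm], by rw [hi, hm]⟩
        · exact ⟨i, by simp [hi], rfl⟩)
      (by rw [Finset.card_erase_of_mem (Finset.mem_univ a), Finset.card_univ]; omega)
    intro i j hi hj hij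
    exact hinj (by simp [hi]) (by simp [hj]) hij
  exact ⟨a, b, hab, hm, key a b hab hm, key b a hab.symm hm.symm⟩

/-- Pivoting: a dominant set with one element fewer than the number of rankings, all of whose
open upper regions are nonempty, extends by one point to a dominant set in exactly two ways. -/
theorem IsDominant.exists_two_extensions {W I α : Type*} [LinearOrder α] [Fintype I] [Finite W]
    [DecidableEq W] {r : I → W → α} (hr : ∀ i, Function.Injective (r i)) {τ : Finset W}
    (hcard : τ.card + 1 = Fintype.card I) (hD : IsDominant r τ) (hne : τ.Nonempty)
    (habove : ∀ a, ∃ w, ∀ i, i ≠ a → ∃ x ∈ τ, r i x < r i w) :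
    ∃ y₁ y₂, y₁ ≠ y₂ ∧ ∀ y, (y ∉ τ ∧ IsDominant r (insert y τ)) ↔ y = y₁ ∨ y = y₂ := by
  have hmin : ∀ i, ∃ x ∈ τ, ∀ z ∈ τ, r i x ≤ r i z := fun i => τ.exists_min_image (r i) hne
  choose m hmem hmin using hmin
  have hsurj : ∀ x ∈ τ, ∃ i, m i = x := by
    intro x hx
    obtain ⟨i, hi⟩ := hD x
    exact ⟨i, hr i (le_antisymm (hmin i x hx) (hi _ (hmem i)))⟩
  obtain ⟨a, b, hab, hm, hinja, hinjb⟩ := exists_unique_pair_of_surjective hcard hmem hsurj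
  have hmax : ∀ a, ∃ y, (∀ i, i ≠ a → r i (m i) < r i y) ∧
      ∀ z, (∀ i, i ≠ a → r i (m i) < r i z) → r a z ≤ r a y := by
    intro a
    obtain ⟨w, hw⟩ := habove a
    obtain ⟨y, hy, hy'⟩ := Set.exists_max_image {y | ∀ i, i ≠ a → r i (m i) < r i y} (r a)
      (Set.toFinite _)
      ⟨w, fun i hi => by
        obtain ⟨x, hx, hxw⟩ := hw i hi
        exact (hmin i x hx).trans_lt hxw⟩
    exact ⟨y, hy, hy'⟩
  have hext : ∀ a b y, a ≠ b → m a = m b → (∀ i, i ≠ a → r i (m i) < r i y) →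
      (∀ z, (∀ i, i ≠ a → r i (m i) < r i z) → r a z ≤ r a y) →
      y ∉ τ ∧ IsDominant r (insert y τ) := by
    intro a b y hab hm hy hmaxy
    constructor
    · intro hyτ
      obtain ⟨j, rfl⟩ := hsurj y hyτ
      by_cases hj : j = a
      · subst hj
        have := hy b hab.symm
        rw [hm] at this
        exact this.false
      · exact (hy j hj).false
    · have hya : r a y ≤ r a (m a) := by
        obtain ⟨i, hi⟩ := hD y
        by_cases hia : i = a
        · subst hia; exact hi _ (hmem i)
        · exact absurd (hi _ (hmem i)) (not_le.2 (hy i hia))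
      intro z
      by_cases hz : ∀ i, i ≠ a → r i (m i) < r i z
      · refine ⟨a, fun x hx => ?_⟩
        rcases Finset.mem_insert.1 hx with rfl | hx
        · exact hmaxy z hz
        · exact (hmaxy z hz).trans (hya.trans (hmin a x hx))
      · push Not at hz
        obtain ⟨i, hia, hi⟩ := hz
        refine ⟨i, fun x hx => ?_⟩
        rcases Finset.mem_insert.1 hx with rfl | hx
        · exact hi.trans (hy i hia).le
        · exact hi.trans (hmin i x hx)
  have huniq : ∀ a b y k, a ≠ b → m a = m b → (∀ i j, i ≠ a → j ≠ a → m i = m j → i = j) →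
      y ∉ τ → IsDominant r (insert y τ) → k = a → (∀ x ∈ insert y τ, r k y ≤ r k x) →
      (∀ i, i ≠ a → r i (m i) < r i y) ∧
      (∀ z, (∀ i, i ≠ a → r i (m i) < r i z) → r a z ≤ r a y) := by
    rintro a b y k hab hm hinj hyτ hDy rfl hk
    have hlt : ∀ i, r i (m i) ≤ r i y → r i (m i) < r i y := fun i hi =>
      lt_of_le_of_ne hi fun h => hyτ (hr i h ▸ hmem i)
    constructor
    · intro i hi
      obtain ⟨j, hj⟩ := hDy (m i)
      have hji : m j = m i := hr j (le_antisymm (hmin j _ (hmem i))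
        (hj _ (Finset.mem_insert_of_mem (hmem j))))
      by_cases hjk : j = k
      · subst hjk
        have h1 := hk _ (Finset.mem_insert_of_mem (hmem j))
        have h2 := hj y (Finset.mem_insert_self _ _)
        rw [← hji] at h2
        exact absurd h1 (not_le.2 (hlt _ h2))
      · obtain rfl := hinj j i hjk hi hji
        exact hlt _ (hj y (Finset.mem_insert_self _ _))
    · intro z hz
      obtain ⟨i, hi⟩ := hDy z
      by_cases hik : i = k
      · subst hik; exact hi y (Finset.mem_insert_self _ _)
      · exact absurd (hi _ (Finset.mem_insert_of_mem (hmem i))) (not_le.2 (hz i hik))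
  obtain ⟨ya, hya, hya'⟩ := hmax a
  obtain ⟨yb, hyb, hyb'⟩ := hmax b
  have hDa := hext a b ya hab hm hya hya'
  have hDb := hext b a yb hab.symm hm.symm hyb hyb'
  refine ⟨ya, yb, ?_, fun y => ⟨?_, ?_⟩⟩
  · rintro rfl
    obtain ⟨i, hi⟩ := hD ya
    by_cases hia : i = a
    · exact absurd (hi _ (hmem i)) (not_le.2 (hyb i (hia ▸ hab)))
    · exact absurd (hi _ (hmem i)) (not_le.2 (hya i hia))
  · rintro ⟨hy, hDy⟩
    obtain ⟨k, hk⟩ := hDy y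
    by_cases hka : k = a
    · left
      obtain ⟨h1, h2⟩ := huniq a b y k hab hm hinja hy hDy hka hk
      exact hr a (le_antisymm (hya' y h1) (h2 ya hya))
    by_cases hkb : k = b
    · right
      obtain ⟨h1, h2⟩ := huniq b a y k hab.symm hm.symm hinjb hy hDy hkb hk
      exact hr b (le_antisymm (hyb' y h1) (h2 yb hyb))
    exfalso
    obtain ⟨j, hj⟩ := hDy (m k)
    have hjk : m j = m k := hr j (le_antisymm (hmin j _ (hmem k))
      (hj _ (Finset.mem_insert_of_mem (hmem j))))
    have : j = k := by
      by_cases hja : j = a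
      · exact hinjb j k (by rw [hja]; exact hab) hkb hjk
      · exact hinja j k hja hka hjk
    subst this
    exact hy (hr j (le_antisymm (hk _ (Finset.mem_insert_of_mem (hmem j)))
      (hj y (Finset.mem_insert_self _ _))) ▸ hmem j)
  · rintro (rfl | rfl)
    exacts [hDa, hDb]

/-- The parity argument behind Scarf's lemma, in the presence of one sentinel point `s i` per
ranking, lowest for `r i` and above every ordinary point for the other rankings. -/
theorem exists_isDominant_image_eq_univ {W I α : Type*} [LinearOrder α] [Fintype I] [Fintype W]
    [DecidableEq W] [DecidableEq I] {r : I → W → α} (hr : ∀ i, Function.Injective (r i))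
    (s : I → W) (c : W → I) (hcs : ∀ i, c (s i) = i)
    (hlow : ∀ i w, r i (s i) ≤ r i w)
    (hhigh : ∀ i j, j ≠ i → ∀ w, w ∉ Set.range s → r i w < r i (s j))
    (hne : ∃ w, w ∉ Set.range s) (i₀ : I) :
    ∃ σ : Finset W, IsDominant r σ ∧ σ.image c = Finset.univ := by
  classical
  by_contra! hno
  set doors : Finset (Finset W) := Finset.univ.filter fun τ =>
    IsDominant r τ ∧ τ.card + 1 = Fintype.card I ∧ τ.image c = Finset.univ.erase i₀ with hdoors
  set pairs : Finset (Finset W × W) := Finset.univ.filter fun p =>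
    p.1 ∈ doors ∧ p.2 ∉ p.1 ∧ IsDominant r (insert p.2 p.1) with hpairs
  set τ₀ : Finset W := (Finset.univ.erase i₀).image s with hτ₀
  have hs : Function.Injective s := fun i j h => by rw [← hcs i, ← hcs j, h]
  have hcard_pos : 0 < Fintype.card I := Fintype.card_pos_iff.2 ⟨i₀⟩
  -- every door with an ordinary point has two extensions
  have htwo : ∀ τ ∈ doors, τ ≠ τ₀ →
      (Finset.univ.filter fun y => y ∉ τ ∧ IsDominant r (insert y τ)).card = 2 := by
    intro τ hτ hττ₀
    simp only [hdoors, Finset.mem_filter, Finset.mem_univ, true_and] at hτ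
    obtain ⟨hD, hcard, himg⟩ := hτ
    have hord : ∃ t ∈ τ, t ∉ Set.range s := by
      by_contra! hall
      apply hττ₀
      ext w
      simp only [hτ₀, Finset.mem_image, Finset.mem_erase, Finset.mem_univ, and_true]
      constructor
      · intro hw
        obtain ⟨j, rfl⟩ := hall w hw
        have : c (s j) ∈ Finset.univ.erase i₀ := himg ▸ Finset.mem_image_of_mem c hw
        rw [hcs] at this
        exact ⟨j, (Finset.mem_erase.1 this).1, rfl⟩
      · rintro ⟨j, hj, rfl⟩
        have : j ∈ τ.image c := by rw [himg]; simp [hj]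
        obtain ⟨w, hw, hwj⟩ := Finset.mem_image.1 this
        obtain ⟨k, rfl⟩ := hall w hw
        rw [hcs] at hwj
        exact hwj ▸ hw
    obtain ⟨t, ht, hts⟩ := hord
    obtain ⟨y₁, y₂, hy, hiff⟩ := hD.exists_two_extensions hr hcard ⟨t, ht⟩
      fun a => ⟨s a, fun i hi => ⟨t, ht, hhigh i a hi.symm t hts⟩⟩
    rw [Finset.card_eq_two]
    exact ⟨y₁, y₂, hy, by ext y; simp [hiff]⟩
  -- the door made of sentinels has one extension
  have hone : τ₀ ∈ doors ∧
      (Finset.univ.filter fun y => y ∉ τ₀ ∧ IsDominant r (insert y τ₀)).card = 1 := by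
    obtain ⟨t, ht, htmax⟩ := Set.exists_max_image {w | w ∉ Set.range s} (r i₀)
      (Set.toFinite _) hne
    have hnot : ∀ i w, w ∉ Set.range s → ¬ r i w ≤ r i (s i) := fun i w hw h =>
      hw ⟨i, hr i (le_antisymm (hlow i w) h)⟩
    have hiff : ∀ y, (y ∉ τ₀ ∧ IsDominant r (insert y τ₀)) ↔ y = t := by
      intro y
      constructor
      · rintro ⟨hy, hDy⟩
        obtain ⟨i, hi⟩ := hDy t
        have hii : i = i₀ := by
          by_contra hii
          exact hnot i t ht (hi _ (Finset.mem_insert_of_mem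
            (Finset.mem_image_of_mem s (by simp [hii]))))
        subst hii
        have hty := hi y (Finset.mem_insert_self _ _)
        by_cases hys : y ∈ Set.range s
        · obtain ⟨j, rfl⟩ := hys
          have hji : j = i := by
            by_contra hji
            exact hy (Finset.mem_image_of_mem s (by simp [hji]))
          subst hji
          exact absurd hty (hnot _ t ht)
        · exact hr i (le_antisymm (htmax y hys) hty)
      · rintro rfl
        refine ⟨fun h => ?_, fun z => ?_⟩
        · obtain ⟨j, -, hj⟩ := Finset.mem_image.1 h
          exact ht ⟨j, hj⟩
        · by_cases hz : z ∈ Set.range s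
          · obtain ⟨j, rfl⟩ := hz
            exact ⟨j, fun x _ => hlow j x⟩
          · refine ⟨i₀, fun x hx => ?_⟩
            rcases Finset.mem_insert.1 hx with rfl | hx
            · exact htmax z hz
            · obtain ⟨j, hj, rfl⟩ := Finset.mem_image.1 hx
              exact (hhigh i₀ j (Finset.mem_erase.1 hj).1 z hz).le
    refine ⟨?_, ?_⟩
    · simp only [hdoors, Finset.mem_filter, Finset.mem_univ, true_and]
      refine ⟨((hiff t).2 rfl).2.mono (Finset.subset_insert _ _), ?_, ?_⟩
      · rw [hτ₀, Finset.card_image_of_injective _ hs, Finset.card_erase_of_mem (Finset.mem_univ _),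
          Finset.card_univ]
        omega
      · rw [hτ₀, Finset.image_image]
        have : c ∘ s = id := funext hcs
        rw [this, Finset.image_id]
    · rw [Finset.card_eq_one]
      exact ⟨t, by ext y; simp [hiff]⟩
  have hfiber : pairs.card = ∑ τ ∈ doors,
      (Finset.univ.filter fun y => y ∉ τ ∧ IsDominant r (insert y τ)).card := by
    rw [Finset.card_eq_sum_card_fiberwise (f := Prod.fst) (t := doors)
      (fun p hp => by simp [hpairs] at hp; exact hp.1)]
    refine Finset.sum_congr rfl fun τ hτ => ?_
    refine Finset.card_bij (fun p _ => p.2) ?_ ?_ ?_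
    · rintro ⟨τ', y⟩ hp
      simp only [hpairs, Finset.mem_filter, Finset.mem_univ, true_and] at hp ⊢
      obtain ⟨⟨-, h⟩, rfl⟩ := hp
      exact h
    · rintro ⟨τ₁, y₁⟩ h₁ ⟨τ₂, y₂⟩ h₂ h
      simp only [Finset.mem_filter] at h₁ h₂
      exact Prod.ext (h₁.2.trans h₂.2.symm) h
    · intro y hy
      simp only [Finset.mem_filter, Finset.mem_univ, true_and] at hy
      exact ⟨(τ, y), by simp [hpairs, hτ, hy], rfl⟩
  have hodd : Odd pairs.card := by
    rw [hfiber, ← Finset.add_sum_erase _ _ hone.1, hone.2,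
      Finset.sum_congr rfl fun τ hτ => htwo τ (Finset.mem_erase.1 hτ).2 (Finset.mem_erase.1 hτ).1]
    simp only [Finset.sum_const, smul_eq_mul]
    exact ⟨(doors.erase τ₀).card, by ring⟩
  -- in every extended door exactly one other point can be removed to give a door
  have hswap : ∀ p ∈ pairs, ∃ x ∈ p.1, c x = c p.2 ∧ ∀ z ∈ p.1, c z = c p.2 → z = x := by
    rintro ⟨τ, y⟩ hp
    simp only [hpairs, hdoors, Finset.mem_filter, Finset.mem_univ, true_and] at hp ⊢
    obtain ⟨⟨-, hcard, himg⟩, hy, hD⟩ := hp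
    have hcy : c y ∈ τ.image c := by
      rw [himg, Finset.mem_erase]
      refine ⟨fun h => hno _ hD ?_, Finset.mem_univ _⟩
      rw [Finset.image_insert, himg, h, Finset.insert_erase (Finset.mem_univ _)]
    obtain ⟨x, hx, hxy⟩ := Finset.mem_image.1 hcy
    have hinj : Set.InjOn c τ := by
      rw [← Finset.card_image_iff, himg, Finset.card_erase_of_mem (Finset.mem_univ _),
        Finset.card_univ]
      omega
    exact ⟨x, hx, hxy, fun z hz h => hinj hz hx (h.trans hxy.symm)⟩
  have : Nonempty W := ⟨s i₀⟩
  choose! x hx hcx hxu using hswap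
  have hmem : ∀ p ∈ pairs, ((insert p.2 p.1).erase (x p), x p) ∈ pairs := by
    intro p hp
    have h1 := hx p hp
    have h2 := hcx p hp
    simp only [hpairs, hdoors, Finset.mem_filter, Finset.mem_univ, true_and] at hp ⊢
    obtain ⟨⟨-, hcard, himg⟩, hy, hD⟩ := hp
    have hxi : x p ∈ insert p.2 p.1 := Finset.mem_insert_of_mem h1
    refine ⟨⟨hD.mono (Finset.erase_subset _ _), ?_, ?_⟩, Finset.notMem_erase _ _, ?_⟩
    · rw [Finset.card_erase_of_mem hxi, Finset.card_insert_of_notMem hy]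
      omega
    · rw [← himg]
      ext i
      simp only [Finset.mem_image, Finset.mem_erase, Finset.mem_insert]
      constructor
      · rintro ⟨w, ⟨-, rfl | hw⟩, rfl⟩
        · exact ⟨x p, h1, h2⟩
        · exact ⟨w, hw, rfl⟩
      · rintro ⟨w, hw, rfl⟩
        by_cases hwx : w = x p
        · refine ⟨p.2, ⟨fun h => hy (h ▸ h1), Or.inl rfl⟩, by rw [hwx, h2]⟩
        · exact ⟨w, ⟨hwx, Or.inr hw⟩, rfl⟩
    · rwa [Finset.insert_erase hxi]
  have hsum : ∑ _p ∈ pairs, (1 : ZMod 2) = 0 := by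
    refine Finset.sum_involution (fun p _ => ((insert p.2 p.1).erase (x p), x p)) ?_ ?_ hmem ?_
    · intro p _; decide
    · intro p hp _ h
      have h2 : x p = p.2 := congrArg Prod.snd h
      have h3 := hx p hp
      simp only [hpairs, Finset.mem_filter] at hp
      exact hp.2.2.1 (h2 ▸ h3)
    · intro p hp
      have hq := hmem p hp
      have h1 := hx p hp
      have h2 := hcx p hp
      have hy : p.2 ∉ p.1 := by
        simp only [hpairs, Finset.mem_filter] at hp
        exact hp.2.2.1
      have hpx : p.2 = x ((insert p.2 p.1).erase (x p), x p) := by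
        refine hxu _ hq p.2 ?_ h2.symm
        exact Finset.mem_erase.2 ⟨fun h => hy (h ▸ h1), Finset.mem_insert_self _ _⟩
      refine Prod.ext ?_ hpx.symm
      simp only
      rw [← hpx, Finset.insert_erase (Finset.mem_insert_of_mem h1), Finset.erase_insert hy]
  rw [Finset.sum_const, nsmul_one] at hsum
  exact (Nat.not_even_iff_odd.2 hodd) ((ZMod.natCast_eq_zero_iff_even).1 hsum)

/-- **Scarf's lemma.** For integer-valued rankings `v i` of a finite set and any colouring `c` of
it, some subset `σ` is dominant with respect to the rankings whose indices are colours of `σ`. -/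
theorem exists_dominant_colors {T I : Type*} [Finite T] [Nonempty T] [Finite I] [DecidableEq I]
    (v : I → T → ℤ) (c : T → I) :
    ∃ σ : Finset T, ∀ y, ∃ i ∈ σ.image c, ∀ x ∈ σ, v i y ≤ v i x := by
  classical
  have := Fintype.ofFinite T
  have := Fintype.ofFinite I
  obtain ⟨t₀⟩ := ‹Nonempty T›
  obtain ⟨M, hM⟩ := (Set.finite_range fun p : I × T => v p.1 p.2).bddAbove
  obtain ⟨m, hm⟩ := (Set.finite_range fun p : I × T => v p.1 p.2).bddBelow
  have hM : ∀ i t, v i t ≤ M := fun i t => hM ⟨(i, t), rfl⟩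
  have hm : ∀ i t, m ≤ v i t := fun i t => hm ⟨(i, t), rfl⟩
  let val : I → T ⊕ I → ℤ := fun i => Sum.elim (v i) fun j => if j = i then m - 1 else M + 1
  let e := Fintype.equivFin (T ⊕ I)
  let r : I → T ⊕ I → ℤ ×ₗ Fin (Fintype.card (T ⊕ I)) := fun i w => toLex (val i w, e w)
  have hval : ∀ i w w', r i w ≤ r i w' → val i w ≤ val i w' := by
    intro i w w' h
    rcases (Prod.Lex.le_iff).1 h with h | h
    · exact h.le
    · exact h.1.le
  have hlt : ∀ i w w', val i w < val i w' → r i w < r i w' := fun i w w' h =>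
    (Prod.Lex.lt_iff).2 (Or.inl h)
  have hord : ∀ w : T ⊕ I, w ∉ Set.range (Sum.inr : I → T ⊕ I) → ∃ t, w = Sum.inl t := by
    rintro (t | j) h
    · exact ⟨t, rfl⟩
    · exact absurd ⟨j, rfl⟩ h
  obtain ⟨σ, hD, hσ⟩ := exists_isDominant_image_eq_univ (r := r)
    (fun i w w' h => e.injective (congrArg (fun z => (ofLex z).2) h))
    Sum.inr (Sum.elim c id) (fun _ => rfl)
    (by
      rintro i (t | j)
      · exact (hlt _ _ _ (by simp [val]; have := hm i t; omega)).le
      · by_cases hj : j = i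
        · rw [hj]
        · refine (hlt _ _ _ ?_).le
          simp [val, hj]
          have h1 := hm i t₀
          have h2 := hM i t₀
          omega)
    (by
      intro i j hj w hw
      obtain ⟨t, rfl⟩ := hord w hw
      refine hlt _ _ _ ?_
      simp [val, hj]
      have := hM i t
      omega)
    ⟨Sum.inl t₀, by simp⟩ (c t₀)
  refine ⟨Finset.univ.filter fun t => Sum.inl t ∈ σ, fun y => ?_⟩
  obtain ⟨i, hi⟩ := hD (Sum.inl y)
  refine ⟨i, ?_, fun x hx => ?_⟩
  · have : i ∈ σ.image (Sum.elim c id) := by rw [hσ]; exact Finset.mem_univ _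
    obtain ⟨w, hw, hwi⟩ := Finset.mem_image.1 this
    rcases w with t | j
    · exact Finset.mem_image.2 ⟨t, by simpa using hw, hwi⟩
    · have hji : j = i := hwi
      subst hji
      have h1 := hval _ _ _ (hi _ hw)
      simp [val] at h1
      have := hm j y
      omega
  · exact hval _ _ _ (hi _ (by simpa using hx))

/-- Finite, discretised form of the dual Knaster–Kuratowski–Mazurkiewicz theorem. -/
theorem exists_stdSimplex_approx {ι : Type*} [Fintype ι] [Nonempty ι] (G : ι → Set (ι → ℝ))
    (hG : stdSimplex ℝ ι ⊆ ⋃ i, G i) (N : ℕ) (hN : 0 < N) :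
    ∃ z ∈ stdSimplex ℝ ι, ∀ i, (Fintype.card ι : ℝ) / N ≤ z i →
      ∃ x ∈ stdSimplex ℝ ι, x ∈ G i ∧ dist x z ≤ (Fintype.card ι : ℝ) / N := by
  classical
  let T := {x : ι → Fin (N + 1) // ∑ i, (x i : ℕ) = N}
  have hT : ∀ y : ι → ℕ, ∑ i, y i = N → ∃ t : T, ∀ i, (t.1 i : ℕ) = y i := by
    intro y hy
    refine ⟨⟨fun i => ⟨y i, ?_⟩, hy⟩, fun i => rfl⟩
    have := Finset.single_le_sum (f := y) (fun j _ => Nat.zero_le _) (Finset.mem_univ i)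
    omega
  have : Nonempty T := by
    obtain ⟨i⟩ := ‹Nonempty ι›
    obtain ⟨t, -⟩ := hT (Pi.single i N) (by simp)
    exact ⟨t⟩
  have hNR : (0 : ℝ) < N := by exact_mod_cast hN
  let p : T → ι → ℝ := fun t i => ((t.1 i : ℕ) : ℝ) / N
  have hp : ∀ t, p t ∈ stdSimplex ℝ ι := by
    intro t
    refine ⟨fun i => by positivity, ?_⟩
    simp only [p]
    rw [← Finset.sum_div, ← Nat.cast_sum, t.2, div_self hNR.ne']
  have hc : ∀ t, ∃ i, p t ∈ G i := fun t => Set.mem_iUnion.1 (hG (hp t))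
  choose c hc using hc
  obtain ⟨σ, hσ⟩ := exists_dominant_colors (fun i (t : T) => ((t.1 i : ℕ) : ℤ)) c
  have hσne : σ.Nonempty := by
    obtain ⟨t⟩ := ‹Nonempty T›
    obtain ⟨i, hi, -⟩ := hσ t
    exact Finset.image_nonempty.1 ⟨i, hi⟩
  have hmin : ∀ i, ∃ t ∈ σ, ∀ x ∈ σ, (t.1 i : ℕ) ≤ x.1 i := fun i =>
    σ.exists_min_image (fun t => (t.1 i : ℕ)) hσne
  choose m hm hmin using hmin
  set C := σ.image c with hC
  have hCne : C.Nonempty := hσne.image c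
  have hbig : N < ∑ i ∈ C, (((m i).1 i : ℕ) + 1) := by
    by_contra! hle
    obtain ⟨k, hk⟩ := hCne
    let f : ι → ℕ := fun i => if i ∈ C then ((m i).1 i : ℕ) + 1 else 0
    have hf : ∑ i, f i = ∑ i ∈ C, (((m i).1 i : ℕ) + 1) := by
      simp [f, Finset.sum_ite_mem]
    obtain ⟨t, ht⟩ := hT (f + Pi.single k (N - ∑ i, f i)) (by
      simp only [Pi.add_apply, Finset.sum_add_distrib, Finset.sum_pi_single', Finset.mem_univ,
        if_true]
      omega)
    obtain ⟨i, hi, hle'⟩ := hσ t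
    have h1 := hle' (m i) (hm i)
    have h2 : f i = ((m i).1 i : ℕ) + 1 := if_pos hi
    have h3 := ht i
    simp only [Pi.add_apply] at h3
    omega
  rw [Finset.sum_add_distrib, Finset.sum_const, smul_eq_mul, mul_one] at hbig
  have hCcard : C.card ≤ Fintype.card ι := Finset.card_le_univ C
  have hin : ∀ i ∈ C, ∀ x ∈ σ, (x.1 i : ℕ) ≤ (m i).1 i + Fintype.card ι := by
    intro i hi x hx
    have h1 := Finset.add_sum_erase C (fun j => (x.1 j : ℕ)) hi
    have h2 := Finset.add_sum_erase C (fun j => ((m j).1 j : ℕ)) hi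
    have h3 : ∑ j ∈ C.erase i, ((m j).1 j : ℕ) ≤ ∑ j ∈ C.erase i, (x.1 j : ℕ) :=
      Finset.sum_le_sum fun j _ => hmin j x hx
    have h4 : ∑ j ∈ C, (x.1 j : ℕ) ≤ N :=
      (Finset.sum_le_univ_sum_of_nonneg fun _ => Nat.zero_le _).trans_eq x.2
    omega
  have hout : ∀ i ∉ C, ∀ x ∈ σ, (x.1 i : ℕ) < Fintype.card ι := by
    intro i hi x hx
    have h3 : ∑ j ∈ C, ((m j).1 j : ℕ) ≤ ∑ j ∈ C, (x.1 j : ℕ) :=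
      Finset.sum_le_sum fun j _ => hmin j x hx
    have h4 : ∑ j ∈ insert i C, (x.1 j : ℕ) ≤ N :=
      (Finset.sum_le_univ_sum_of_nonneg fun _ => Nat.zero_le _).trans_eq x.2
    rw [Finset.sum_insert hi] at h4
    omega
  obtain ⟨z, hz⟩ := hσne
  refine ⟨p z, hp z, fun i hi => ?_⟩
  have hiC : i ∈ C := by
    by_contra hiC
    have h1 : (Fintype.card ι : ℝ) ≤ ((z.1 i : ℕ) : ℝ) := (div_le_div_iff_of_pos_right hNR).1 hi
    have h2 := hout i hiC z hz
    have h3 : Fintype.card ι ≤ (z.1 i : ℕ) := by exact_mod_cast h1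
    omega
  obtain ⟨x, hx, rfl⟩ := Finset.mem_image.1 hiC
  refine ⟨p x, hp x, hc x, (dist_pi_le_iff (by positivity)).2 fun j => ?_⟩
  rw [Real.dist_eq, ← sub_div, abs_div, abs_of_pos hNR]
  refine (div_le_div_iff_of_pos_right hNR).2 ?_
  have key : (x.1 j : ℕ) ≤ z.1 j + Fintype.card ι ∧ (z.1 j : ℕ) ≤ x.1 j + Fintype.card ι := by
    by_cases hj : j ∈ C
    · have h1 := hin j hj x hx
      have h2 := hin j hj z hz
      have h3 := hmin j x hx
      have h4 := hmin j z hz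
      omega
    · have h1 := hout j hj x hx
      have h2 := hout j hj z hz
      omega
  obtain ⟨h1, h2⟩ := key
  have h1 : ((x.1 j : ℕ) : ℝ) ≤ (z.1 j : ℕ) + Fintype.card ι := by exact_mod_cast h1
  have h2 : ((z.1 j : ℕ) : ℝ) ≤ (x.1 j : ℕ) + Fintype.card ι := by exact_mod_cast h2
  rw [abs_le]
  constructor <;> linarith

/-- **Dual Knaster–Kuratowski–Mazurkiewicz theorem.** If closed sets `G i` cover the standard
simplex, then some point of the simplex lies in `G i` for every `i` in its support. -/
theorem exists_mem_stdSimplex_forall_mem {ι : Type*} [Fintype ι] [Nonempty ι]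
    (G : ι → Set (ι → ℝ)) (hclosed : ∀ i, IsClosed (G i)) (hG : stdSimplex ℝ ι ⊆ ⋃ i, G i) :
    ∃ z ∈ stdSimplex ℝ ι, ∀ i, 0 < z i → z ∈ G i := by
  choose z hz hzG using fun k : ℕ => exists_stdSimplex_approx G hG (k + 1) k.succ_pos
  obtain ⟨a, ha, φ, hφ, hlim⟩ := (isCompact_stdSimplex ℝ ι).tendsto_subseq hz
  refine ⟨a, ha, fun i hi => ?_⟩
  have hsmall : Filter.Tendsto (fun k : ℕ => (Fintype.card ι : ℝ) / ((φ k + 1 : ℕ) : ℝ))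
      Filter.atTop (nhds 0) :=
    ((tendsto_const_div_atTop_nhds_zero_nat (Fintype.card ι : ℝ)).comp
      (Filter.tendsto_add_atTop_nat 1)).comp hφ.tendsto_atTop
  have hlimi : Filter.Tendsto (fun k => z (φ k) i) Filter.atTop (nhds (a i)) :=
    (tendsto_pi_nhds.1 hlim) i
  have hev := hsmall.eventually_lt hlimi hi
  rw [← (hclosed i).closure_eq, Metric.mem_closure_iff]
  intro ε hε
  obtain ⟨k, hk, hk1, hk2⟩ := (hev.and ((hsmall.eventually_lt_const (half_pos hε)).and
    (Metric.tendsto_nhds.1 hlim (ε / 2) (half_pos hε)))).exists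
  obtain ⟨x, -, hxG, hxd⟩ := hzG (φ k) i hk.le
  refine ⟨x, hxG, ?_⟩
  have h1 := dist_triangle_right a x (z (φ k))
  have h2 : dist (z (φ k)) a < ε / 2 := hk2
  rw [dist_comm] at h2
  linarith

/-- If finitely many closed sets `G k` cover the convex set `X`, then for any points `y k` of `X`
some point `s` of `X` lies in the convex hull of those `y k` with `s ∈ G k`. -/
theorem exists_mem_convexHull_of_closed_cover {E ι : Type*} [AddCommGroup E] [Module ℝ E]
    [TopologicalSpace E] [ContinuousAdd E] [ContinuousSMul ℝ E] [Finite ι] [Nonempty ι]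
    {X : Set E} (hX : Convex ℝ X) (y : ι → E) (hy : ∀ k, y k ∈ X) (G : ι → Set E)
    (hclosed : ∀ k, IsClosed (G k)) (hG : X ⊆ ⋃ k, G k) :
    ∃ s ∈ X, s ∈ convexHull ℝ (y '' {k | s ∈ G k}) := by
  classical
  have := Fintype.ofFinite ι
  let p : (ι → ℝ) → E := fun w => ∑ k, w k • y k
  have hp : Continuous p := by fun_prop
  have hpX : ∀ w ∈ stdSimplex ℝ ι, p w ∈ X := fun w hw =>
    hX.sum_mem (fun k _ => hw.1 k) hw.2 fun k _ => hy k
  obtain ⟨w, hw, hwG⟩ := exists_mem_stdSimplex_forall_mem (fun k => p ⁻¹' G k)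
    (fun k => (hclosed k).preimage hp)
    (fun w hw => by
      obtain ⟨k, hk⟩ := Set.mem_iUnion.1 (hG (hpX w hw))
      exact Set.mem_iUnion.2 ⟨k, hk⟩)
  refine ⟨p w, hpX w hw, ?_⟩
  have hsub : ∀ k, k ∉ Finset.univ.filter (fun k => 0 < w k) → w k = 0 := fun k hk =>
    le_antisymm (not_lt.1 fun h => hk (by simp [h])) (hw.1 k)
  have hpw : p w = ∑ k with 0 < w k, w k • y k :=
    (Finset.sum_subset (Finset.subset_univ _) fun k _ hk => by rw [hsub k hk, zero_smul]).symm
  have hsum : ∑ k with 0 < w k, w k = 1 :=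
    (Finset.sum_subset (Finset.subset_univ _) fun k _ hk => hsub k hk).trans hw.2
  have hmem : ∑ k with 0 < w k, w k • y k ∈ convexHull ℝ (y '' {k | p w ∈ G k}) :=
    (convex_convexHull ℝ _).sum_mem (fun k _ => hw.1 k) hsum fun k hk =>
      subset_convexHull ℝ _ ⟨k, hwG k (Finset.mem_filter.1 hk).2, rfl⟩
  rwa [← hpw] at hmem

/-- Existence of `ε`-equilibria on compact convex strategy sets. -/
theorem exists_approx_equilibrium {I : Type*} [Fintype I] [DecidableEq I] {E : I → Type*}
    [∀ i, NormedAddCommGroup (E i)] [∀ i, NormedSpace ℝ (E i)] (S : ∀ i, Set (E i))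
    (u : I → (∀ j, E j) → ℝ) (hne : ∀ i, (S i).Nonempty) (hcomp : ∀ i, IsCompact (S i))
    (hconv : ∀ i, Convex ℝ (S i)) (hcont : ∀ i, ContinuousOn (u i) (Set.univ.pi S))
    (hqc : ∀ i, ∀ s ∈ Set.univ.pi S,
      QuasiconcaveOn ℝ (S i) (fun x => u i (Function.update s i x)))
    {ε : ℝ} (hε : 0 < ε) :
    ∃ s ∈ Set.univ.pi S, ∀ i, ∀ x ∈ S i, u i (Function.update s i x) ≤ u i s + ε := by
  set X := Set.univ.pi S with hX
  have hXcomp : IsCompact X := isCompact_univ_pi hcomp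
  have hXconv : Convex ℝ X := convex_pi fun i _ => hconv i
  have hXne : X.Nonempty := Set.univ_pi_nonempty_iff.2 hne
  have hupd : ∀ s ∈ X, ∀ i, ∀ x ∈ S i, Function.update s i x ∈ X := by
    intro s hs i x hx j _
    by_cases hj : j = i
    · subst hj; simpa using hx
    · simpa [hj] using hs j trivial
  have hcontupd : ∀ i, ∀ x ∈ S i, ContinuousOn (fun s => u i (Function.update s i x)) X :=
    fun i x hx => (hcont i).comp (by fun_prop) fun s hs => hupd s hs i x hx
  have hbest : ∀ s ∈ X, ∃ y ∈ X, ∀ i, ∀ x ∈ S i,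
      u i (Function.update s i x) ≤ u i (Function.update s i (y i)) := by
    intro s hs
    have : ∀ i, ∃ y ∈ S i, ∀ x ∈ S i,
        u i (Function.update s i x) ≤ u i (Function.update s i y) := fun i =>
      (hcomp i).exists_isMaxOn (hne i)
        ((hcont i).comp (by fun_prop) fun x hx => hupd s hs i x hx)
    choose y hy hmax using this
    exact ⟨y, fun i _ => hy i, hmax⟩
  choose! b hbX hb using hbest
  have hunif : ∃ δ > 0, ∀ i, ∀ s ∈ X, ∀ t ∈ X, dist s t < δ → dist (u i s) (u i t) < ε / 2 := by
    have : ∀ i, ∃ δ > 0, ∀ s ∈ X, ∀ t ∈ X, dist s t < δ → dist (u i s) (u i t) < ε / 2 :=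
      fun i => Metric.uniformContinuousOn_iff.1
        (hXcomp.uniformContinuousOn_of_continuous (hcont i)) (ε / 2) (half_pos hε)
    choose δ hδ hu using this
    obtain ⟨d, hd, hdδ⟩ : ∃ d > 0, ∀ i, d ≤ δ i := by
      rcases isEmpty_or_nonempty I with hI | hI
      · exact ⟨1, one_pos, fun i => hI.elim i⟩
      · obtain ⟨i, hi⟩ := Finite.exists_min δ
        exact ⟨δ i, hδ i, hi⟩
    exact ⟨d, hd, fun i s hs t ht h => hu i s hs t ht (h.trans_le (hdδ i))⟩
  obtain ⟨δ, hδ, hunif⟩ := hunif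
  obtain ⟨F, hFX, hFfin, hFcover⟩ := hXcomp.finite_cover_balls hδ
  have : Finite F := hFfin
  have : Nonempty F := by
    obtain ⟨s, hs⟩ := hXne
    obtain ⟨t, ht, -⟩ := Set.mem_iUnion₂.1 (hFcover hs)
    exact ⟨⟨t, ht⟩⟩
  have hdist : ∀ (s t : ∀ j, E j) i x,
      dist (Function.update s i x) (Function.update t i x) ≤ dist s t := by
    intro s t i x
    refine (dist_pi_le_iff dist_nonneg).2 fun j => ?_
    by_cases hj : j = i
    · subst hj; simp
    · simpa [hj] using dist_le_pi_dist s t j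
  obtain ⟨s, hs, hsG⟩ := exists_mem_convexHull_of_closed_cover hXconv (fun t : F => b t)
    (fun t => hbX t (hFX t.2))
    (fun t => {s ∈ X | ∀ i, ∀ x ∈ S i,
      u i (Function.update s i x) ≤ u i (Function.update s i (b t i)) + ε})
    (by
      intro t
      have : {s ∈ X | ∀ i, ∀ x ∈ S i,
          u i (Function.update s i x) ≤ u i (Function.update s i (b t i)) + ε} =
          X ∩ ⋂ i, ⋂ x : S i, {s ∈ X |
            u i (Function.update s i x) ≤ u i (Function.update s i (b t i)) + ε} := by
        ext s
        simp only [Set.mem_ofPred_eq, Set.mem_inter_iff, Set.mem_iInter, Subtype.forall]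
        exact ⟨fun h => ⟨h.1, fun i x hx => ⟨h.1, h.2 i x hx⟩⟩,
          fun h => ⟨h.1, fun i x hx => (h.2 i x hx).2⟩⟩
      rw [this]
      exact hXcomp.isClosed.inter (isClosed_iInter fun i => isClosed_iInter fun x =>
        hXcomp.isClosed.isClosed_le (hcontupd i x x.2)
          ((hcontupd i _ (hbX t (hFX t.2) i trivial)).add continuousOn_const)))
    (by
      intro s hs
      obtain ⟨t, ht, hst⟩ := Set.mem_iUnion₂.1 (hFcover hs)
      refine Set.mem_iUnion.2 ⟨⟨t, ht⟩, hs, fun i x hx => ?_⟩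
      have htX := hFX ht
      have hclose : ∀ x ∈ S i,
          dist (u i (Function.update s i x)) (u i (Function.update t i x)) < ε / 2 :=
        fun x hx => hunif i _ (hupd s hs i x hx) _ (hupd t htX i x hx)
          ((hdist s t i x).trans_lt hst)
      have h1 := abs_lt.1 (Real.dist_eq _ _ ▸ hclose x hx)
      have h2 := abs_lt.1 (Real.dist_eq _ _ ▸ hclose _ (hbX t htX i trivial))
      have h3 := hb t htX i x hx
      linarith [h1.1, h1.2, h2.1, h2.2])
  refine ⟨s, hs, fun i x hx => ?_⟩
  have hconvB : Convex ℝ ((fun y : ∀ j, E j => y i) ⁻¹'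
      {z ∈ S i | u i (Function.update s i x) - ε ≤ u i (Function.update s i z)}) :=
    (hqc i s hs _).linear_preimage (LinearMap.proj (R := ℝ) (φ := E) i)
  have hmem := convexHull_min (t := (fun y : ∀ j, E j => y i) ⁻¹'
      {z ∈ S i | u i (Function.update s i x) - ε ≤ u i (Function.update s i z)}) (by
    rintro _ ⟨t, ⟨-, ht⟩, rfl⟩
    refine ⟨hbX t (hFX t.2) i trivial, ?_⟩
    have := ht i x hx
    simp only
    linarith) hconvB hsG
  have h := hmem.2
  rw [Function.update_eq_self] at h
  linarith


/-- **Debreu–Fan–Glicksberg (1952).** A strategic-form game with finitely many players,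
nonempty compact convex strategy sets `S i ⊆ ℝ^{n i}`, utilities continuous on the product
of the strategy sets and quasi-concave in the player's own strategy, has at least one
pure-strategy Nash equilibrium. -/
theorem debreu_fan_glicksberg
    {K : ℕ} (n : Fin K → ℕ)
    (S : ∀ i : Fin K, Set (EuclideanSpace ℝ (Fin (n i))))
    (u : ∀ _ : Fin K, (∀ j : Fin K, EuclideanSpace ℝ (Fin (n j))) → ℝ)
    (hne : ∀ i, (S i).Nonempty)
    (hcomp : ∀ i, IsCompact (S i))
    (hconv : ∀ i, Convex ℝ (S i))
    (hcont : ∀ i, ContinuousOn (u i) (Set.univ.pi S))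
    (hqc : ∀ i, ∀ s ∈ Set.univ.pi S,
      QuasiconcaveOn ℝ (S i) (fun x => u i (Function.update s i x))) :
    ∃ s ∈ Set.univ.pi S, ∀ i, ∀ s' ∈ S i,
      u i (Function.update s i s') ≤ u i s := by
  choose s hs happrox using fun k : ℕ =>
    exists_approx_equilibrium S u hne hcomp hconv hcont hqc (Nat.one_div_pos_of_nat (n := k))
  obtain ⟨a, ha, φ, hφ, hlim⟩ := (isCompact_univ_pi hcomp).tendsto_subseq hs
  refine ⟨a, ha, fun i x hx => ?_⟩
  have hupd : ∀ t ∈ Set.univ.pi S, Function.update t i x ∈ Set.univ.pi S := by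
    intro t ht j _
    by_cases hj : j = i
    · subst hj; simpa using hx
    · simpa [hj] using ht j trivial
  have hcontupd : ContinuousOn (fun t => u i (Function.update t i x)) (Set.univ.pi S) :=
    (hcont i).comp (by fun_prop) fun t ht => hupd t ht
  have hin : Filter.Tendsto (s ∘ φ) Filter.atTop (nhdsWithin a (Set.univ.pi S)) :=
    tendsto_nhdsWithin_iff.2 ⟨hlim, Filter.Eventually.of_forall fun k => hs (φ k)⟩
  have hleft : Filter.Tendsto (fun k => u i (Function.update (s (φ k)) i x)) Filter.atTop
      (nhds (u i (Function.update a i x))) :=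
    (hcontupd a ha).tendsto.comp hin
  have hright : Filter.Tendsto (fun k => u i (s (φ k)) + 1 / ((φ k : ℝ) + 1)) Filter.atTop
      (nhds (u i a + 0)) :=
    ((hcont i a ha).tendsto.comp hin).add
      (tendsto_one_div_add_atTop_nhds_zero_nat.comp hφ.tendsto_atTop)
  rw [add_zero] at hright
  exact le_of_tendsto_of_tendsto' hleft hright fun k => happrox (φ k) i x hx
end

section
/- Theorem (Rosen, 1965, existence in concave games). Let G be a strategic-form game with finitely many players in which, for every player i, the strategy set S_i is a nonempty, compact and convex subset of ℝ^{m_i}, and the utility u_i : S_1 × ... × S_K → ℝ is continuous in the full strategy profile and concave in the player's own strategy s_i for every fixed s_{-i}. Then G has at least one pure-strategy Nash equilibrium. -/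
open MeasureTheory Metric Set Filter Topology
open scoped NNReal

/-- Lagrange interpolation of `t ↦ det (1 + t A)`, a polynomial of degree at most the dimension. -/
theorem det_id_add_eq_sum_lagrange {E : Type*} [NormedAddCommGroup E] [NormedSpace ℝ E]
    [FiniteDimensional ℝ E] (A : E →L[ℝ] E) {s : Finset ℝ}
    (hs : Module.finrank ℝ E < s.card) :
    (ContinuousLinearMap.id ℝ E + A).det =
      ∑ t ∈ s, (ContinuousLinearMap.id ℝ E + t • A).det * (Lagrange.basis s id t).eval 1 := by
  classical
  let n := Module.finrank ℝ E
  let b : Module.Basis (Fin n) ℝ E := Module.finBasis ℝ E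
  let M : Matrix (Fin n) (Fin n) ℝ := LinearMap.toMatrix b b (A : E →ₗ[ℝ] E)
  let p : Polynomial ℝ := ((Polynomial.X : Polynomial ℝ) • M.map ⇑(Polynomial.C : ℝ →+* _) +
    (1 : Matrix (Fin n) (Fin n) ℝ).map ⇑(Polynomial.C : ℝ →+* _)).det
  have hev : ∀ t : ℝ, p.eval t = (ContinuousLinearMap.id ℝ E + t • A).det := by
    intro t
    have h1 : (ContinuousLinearMap.id ℝ E + t • A).det = (t • M + 1).det := by
      rw [ContinuousLinearMap.det, ← LinearMap.det_toMatrix b]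
      have h2 : ((ContinuousLinearMap.id ℝ E + t • A : E →L[ℝ] E) : E →ₗ[ℝ] E) =
          t • (A : E →ₗ[ℝ] E) + LinearMap.id := add_comm _ _
      rw [h2, map_add, map_smul, LinearMap.toMatrix_id]
    rw [h1, ← Polynomial.coe_evalRingHom, RingHom.map_det]
    congr 1
    ext i j
    change (Polynomial.X * Polynomial.C (M i j) + Polynomial.C ((1 : Matrix _ _ ℝ) i j)).eval t =
      t * M i j + (1 : Matrix _ _ ℝ) i j
    rw [Polynomial.eval_add, Polynomial.eval_mul, Polynomial.eval_X, Polynomial.eval_C,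
      Polynomial.eval_C]
  have hdeg : p.degree < s.card := by
    refine lt_of_le_of_lt Polynomial.degree_le_natDegree ?_
    have := Polynomial.natDegree_det_X_add_C_le M 1
    rw [Fintype.card_fin] at this
    exact_mod_cast this.trans_lt hs
  have h := Lagrange.eq_interpolate (s := s) (v := id) (Function.injective_id.injOn) hdeg
  have h1 := hev 1
  rw [one_smul] at h1
  rw [← h1, h, Lagrange.interpolate_apply, Polynomial.eval_finsetSum]
  simp [hev]

/-- The derivative of a map with locally constant positive norm is singular. -/
theorem det_fderiv_eq_zero_of_norm_eq {E : Type*} [NormedAddCommGroup E] [InnerProductSpace ℝ E]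
    [FiniteDimensional ℝ E] {r : E → E} {r' : E →L[ℝ] E} {x : E} {R : ℝ} (hR : 0 < R)
    (hr : HasFDerivAt r r' x) (hn : ∀ᶠ y in 𝓝 x, ‖r y‖ = R) : r'.det = 0 := by
  by_contra hdet
  have h1 : HasFDerivAt (fun y => ‖r y‖ ^ 2) (2 • (innerSL ℝ (r x)).comp r') x := hr.norm_sq
  have h2 : HasFDerivAt (fun y => ‖r y‖ ^ 2) (0 : E →L[ℝ] ℝ) x :=
    (hasFDerivAt_const (R ^ 2) x).congr_of_eventuallyEq (by
      filter_upwards [hn] with y hy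
      rw [hy])
  have h3 := h1.unique h2
  have hu : IsUnit (r' : E →ₗ[ℝ] E) :=
    (LinearMap.isUnit_iff_isUnit_det _).2 (isUnit_iff_ne_zero.2 hdet)
  obtain ⟨v, hv⟩ := ((Module.End.isUnit_iff _).1 hu).2 (r x)
  have h4 := congrArg (fun L : E →L[ℝ] ℝ => L v) h3
  have hv' : r' v = r x := hv
  simp [hv'] at h4
  have := hn.self_of_nhds
  simp [h4] at this
  exact hR.ne this

/-- A map that is Lipschitz on a closed ball and vanishes elsewhere and on the bounding sphere is
Lipschitz. -/
theorem lipschitzWith_of_lipschitzOnWith_closedBall {E F : Type*} [NormedAddCommGroup E]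
    [NormedSpace ℝ E] [NormedAddCommGroup F] {g : E → F} {R : ℝ} {C : ℝ≥0}
    (hg : LipschitzOnWith C g (closedBall 0 R)) (h0 : ∀ x, R ≤ ‖x‖ → g x = 0) :
    LipschitzWith C g := by
  have key : ∀ x y, ‖x‖ ≤ R → R ≤ ‖y‖ → dist (g x) (g y) ≤ C * dist x y := by
    intro x y hx hy
    have hc : ContinuousOn (fun t : ℝ => ‖AffineMap.lineMap x y t‖) (Icc 0 1) := by
      apply Continuous.continuousOn
      exact (AffineMap.lineMap_continuous (p := x) (q := y)).norm
    obtain ⟨t, ht, hz⟩ := intermediate_value_Icc zero_le_one hc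
      (show R ∈ Icc _ _ by simpa using ⟨hx, hy⟩)
    have h1 := hg.dist_le_mul x (by simpa using hx) (AffineMap.lineMap x y t) (by
      simpa using hz.le)
    rw [h0 _ hy, ← h0 (AffineMap.lineMap x y t) hz.ge]
    refine h1.trans ?_
    rw [dist_left_lineMap, Real.norm_of_nonneg ht.1]
    have : t * dist x y ≤ dist x y := mul_le_of_le_one_left dist_nonneg ht.2
    gcongr
  refine LipschitzWith.of_dist_le_mul fun x y => ?_
  rcases le_total ‖x‖ R with hx | hx <;> rcases le_total ‖y‖ R with hy | hy
  · exact hg.dist_le_mul x (by simpa using hx) y (by simpa using hy)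
  · exact key x y hx hy
  · rw [dist_comm, dist_comm x]
    exact key y x hy hx
  · rw [h0 x hx, h0 y hy, dist_self]
    positivity

/-- Linear maps close to the identity have positive determinant. -/
theorem exists_pos_forall_det_id_add_pos {E : Type*} [NormedAddCommGroup E] [NormedSpace ℝ E] :
    ∃ δ > 0, ∀ A : E →L[ℝ] E, ‖A‖ < δ → 0 < (ContinuousLinearMap.id ℝ E + A).det := by
  have hc : Continuous fun A : E →L[ℝ] E => (ContinuousLinearMap.id ℝ E + A).det :=
    ContinuousLinearMap.continuous_det.comp (continuous_const.add continuous_id)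
  have h0 : 0 < (ContinuousLinearMap.id ℝ E + 0).det := by
    simp [ContinuousLinearMap.det]
  obtain ⟨δ, hδ, h⟩ := Metric.eventually_nhds_iff.1 (hc.continuousAt.eventually_const_lt h0)
  exact ⟨δ, hδ, fun A hA => h (by simpa using hA)⟩

/-- A perturbation of the identity by a contraction supported in a ball is injective and maps that
ball onto itself. -/
theorem image_ball_of_lipschitz_perturbation {E : Type*} [NormedAddCommGroup E]
    [NormedSpace ℝ E] [CompleteSpace E] {g : E → E} {R : ℝ} {c : ℝ≥0} (hc : c < 1)
    (hg : LipschitzWith c g) (h0 : ∀ x, R ≤ ‖x‖ → g x = 0) :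
    Function.Injective (fun x => x + g x) ∧
      (fun x => x + g x) '' ball 0 R = ball 0 R := by
  have happ : ApproximatesLinearOn (fun x => x + g x)
      ((ContinuousLinearEquiv.refl ℝ E : E ≃L[ℝ] E) : E →L[ℝ] E) univ c := by
    intro x _ y _
    have := hg.norm_sub_le x y
    simpa [add_sub_add_comm] using this
  have hN : Subsingleton E ∨
      c < ‖((ContinuousLinearEquiv.refl ℝ E).symm : E →L[ℝ] E)‖₊⁻¹ := by
    rcases subsingleton_or_nontrivial E with h | h
    · exact Or.inl h
    · right
      have : ‖((ContinuousLinearEquiv.refl ℝ E).symm : E →L[ℝ] E)‖₊ = 1 :=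
        NNReal.eq ContinuousLinearMap.norm_id
      simpa [this] using hc
  have hinj : Function.Injective (fun x => x + g x) := fun x y hxy =>
    injOn_iff_injective.2 (happ.injective hN) (mem_univ x) (mem_univ y) hxy
  have hfix : ∀ x, R ≤ ‖x‖ → x + g x = x := fun x hx => by rw [h0 x hx, add_zero]
  refine ⟨hinj, Subset.antisymm ?_ fun y hy => ?_⟩
  · rintro _ ⟨x, hx, rfl⟩
    by_contra hout
    have hout' : R ≤ ‖x + g x‖ := by simpa using hout
    have : x + g x = x := hinj (hfix _ hout')
    exact hout (mem_of_eq_of_mem this hx)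
  · obtain ⟨x, hx⟩ := happ.surjective hN y
    refine ⟨x, ?_, hx⟩
    by_contra hout
    have hxy : x = y := (hfix x (by simpa using hout)).symm.trans hx
    exact hout (hxy ▸ hy)

/-- No-retraction theorem: no `C¹` map sends a closed ball to its bounding sphere and fixes the
sphere. The volume of the image of the ball under `x + t (r x - x)` is polynomial in `t` and equals
the volume of the ball for small `t`, but the integrand vanishes at `t = 1`. -/
theorem not_exists_contDiff_retraction {E : Type*} [NormedAddCommGroup E]
    [InnerProductSpace ℝ E] [FiniteDimensional ℝ E] {r : E → E} {R : ℝ} (hR : 0 < R)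
    (hr : ContDiff ℝ 1 r) (hfix : ∀ x, ‖x‖ = R → r x = x) (hnorm : ∀ x, ‖x‖ ≤ R → ‖r x‖ = R) :
    False := by
  classical
  let _ : MeasurableSpace E := borel E
  have : BorelSpace E := ⟨rfl⟩
  set B : Set E := ball 0 R with hB
  let A : E → E →L[ℝ] E := fun x => fderiv ℝ r x - ContinuousLinearMap.id ℝ E
  have hAcont : Continuous A := (hr.continuous_fderiv one_ne_zero).sub continuous_const
  let g : E → E := fun x => if ‖x‖ < R then r x - x else 0
  have hg0 : ∀ x, R ≤ ‖x‖ → g x = 0 := fun x hx => if_neg hx.not_gt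
  have hgr : EqOn g (fun x => r x - x) (closedBall 0 R) := by
    intro x hx
    rcases (mem_closedBall_zero_iff.1 hx).lt_or_eq with h | h
    · exact if_pos h
    · simp [hg0 x h.ge, hfix x h]
  obtain ⟨C, hC⟩ := (hr.sub contDiff_id).contDiffOn.exists_lipschitzOnWith one_ne_zero
    (convex_closedBall (0 : E) R) (isCompact_closedBall 0 R)
  have hLip : LipschitzWith C g := by
    refine lipschitzWith_of_lipschitzOnWith_closedBall (R := R) (fun x hx y hy => ?_) hg0
    rw [hgr hx, hgr hy]
    exact hC hx hy
  have hgA : ∀ x ∈ B, HasFDerivAt g (A x) x := by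
    intro x hx
    have h1 : HasFDerivAt (fun x => r x - x) (A x) x :=
      ((hr.differentiable one_ne_zero) x).hasFDerivAt.sub (hasFDerivAt_id x)
    refine h1.congr_of_eventuallyEq ?_
    filter_upwards [isOpen_ball.mem_nhds hx] with y hy
    exact hgr (ball_subset_closedBall hy)
  have hAC : ∀ x ∈ B, ‖A x‖ ≤ C := fun x hx => by
    rw [← (hgA x hx).fderiv]
    exact norm_fderiv_le_of_lipschitz ℝ hLip
  obtain ⟨δ, hδ, hdet⟩ := exists_pos_forall_det_id_add_pos (E := E)
  obtain ⟨τ, hτ, hτδ, hτ1⟩ : ∃ τ : ℝ, 0 < τ ∧ τ * C < δ ∧ τ * C < 1 := by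
    refine ⟨min δ 1 / (C + 1), by positivity, ?_, ?_⟩
    all_goals
      rw [div_mul_eq_mul_div, div_lt_iff₀ (by positivity)]
      have : 0 < min δ 1 := by positivity
      nlinarith [min_le_left δ 1, min_le_right δ 1, C.2]
  have hvol : ∀ t ∈ Ioc 0 τ,
      ∫ x in B, (ContinuousLinearMap.id ℝ E + t • A x).det = volume.real B := by
    intro t ht
    have htC : t * C ≤ τ * C := mul_le_mul_of_nonneg_right ht.2 C.2
    have hLt : LipschitzWith (⟨t, ht.1.le⟩ * C) (fun x => t • g x) := by
      refine LipschitzWith.of_dist_le_mul fun x y => ?_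
      rw [dist_smul₀, Real.norm_of_nonneg ht.1.le]
      have := mul_le_mul_of_nonneg_left (hLip.dist_le_mul x y) ht.1.le
      exact this.trans_eq (mul_assoc _ _ _).symm
    obtain ⟨hinj, himg⟩ := image_ball_of_lipschitz_perturbation (R := R)
      (show (⟨t, ht.1.le⟩ * C : ℝ≥0) < 1 from htC.trans_lt hτ1) hLt
      (fun x hx => by rw [hg0 x hx, smul_zero])
    have hcv := integral_image_eq_integral_abs_det_fderiv_smul (s := B)
      (f := fun x => x + t • g x) (f' := fun x => ContinuousLinearMap.id ℝ E + t • A x)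
      volume measurableSet_ball
      (fun x hx => ((hasFDerivAt_id x).add ((hgA x hx).const_smul t)).hasFDerivWithinAt)
      hinj.injOn (fun _ => (1 : ℝ))
    rw [himg] at hcv
    rw [setIntegral_const, smul_eq_mul, mul_one] at hcv
    rw [hcv]
    refine setIntegral_congr_fun measurableSet_ball fun x hx => ?_
    have hpos : 0 < (ContinuousLinearMap.id ℝ E + t • A x).det := by
      refine hdet _ ?_
      rw [norm_smul, Real.norm_of_nonneg ht.1.le]
      exact ((mul_le_mul_of_nonneg_left (hAC x hx) ht.1.le).trans htC).trans_lt hτδ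
    simp [abs_of_pos hpos]
  obtain ⟨s, hs, hcard⟩ := (Ioc_infinite hτ).exists_subset_card_eq (Module.finrank ℝ E + 1)
  have hint : ∀ t : ℝ,
      IntegrableOn (fun x => (ContinuousLinearMap.id ℝ E + t • A x).det) B := fun t => by
    have hcont : Continuous fun x => (ContinuousLinearMap.id ℝ E + t • A x).det :=
      ContinuousLinearMap.continuous_det.comp (continuous_const.add (hAcont.const_smul t))
    exact (hcont.continuousOn.integrableOn_compact (isCompact_closedBall 0 R)).mono_set
      ball_subset_closedBall
  have hzero : ∫ x in B, (ContinuousLinearMap.id ℝ E + A x).det = 0 := by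
    refine setIntegral_eq_zero_of_forall_eq_zero fun x hx => ?_
    have : ContinuousLinearMap.id ℝ E + A x = fderiv ℝ r x := add_sub_cancel _ _
    rw [this]
    refine det_fderiv_eq_zero_of_norm_eq hR ((hr.differentiable one_ne_zero) x).hasFDerivAt ?_
    filter_upwards [isOpen_ball.mem_nhds hx] with y hy
    exact hnorm y (mem_closedBall_zero_iff.1 (ball_subset_closedBall hy))
  have hsum : ∑ t ∈ s, (Lagrange.basis s id t).eval 1 = 1 := by
    rw [← Polynomial.eval_finsetSum, Lagrange.sum_basis Function.injective_id.injOn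
      (Finset.card_pos.1 (by omega)), Polynomial.eval_one]
  have hone : ∫ x in B, (ContinuousLinearMap.id ℝ E + A x).det = volume.real B := by
    simp_rw [fun x => det_id_add_eq_sum_lagrange (A x) (s := s) (by omega)]
    rw [integral_finsetSum _ fun t _ => (hint t).mul_const _]
    simp_rw [integral_mul_const]
    rw [Finset.sum_congr rfl fun t ht => by rw [hvol t (hs ht)], ← Finset.mul_sum, hsum, mul_one]
  have hBpos : 0 < volume.real B :=
    ENNReal.toReal_pos (measure_ball_pos volume 0 hR).ne' measure_ball_lt_top.ne
  linarith

theorem convex_setOf_imp {E : Type*} [AddCommMonoid E] [Module ℝ E] {p : Prop} {s : Set E}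
    (h : p → Convex ℝ s) : Convex ℝ {v | p → v ∈ s} :=
  fun _ hx _ hy _ _ ha hb hab hp => h hp (hx hp) (hy hp) ha hb hab

/-- **Ky Fan's minimax inequality** in finite dimension. -/
theorem exists_forall_le_zero_of_concaveOn {E : Type*} [NormedAddCommGroup E]
    [InnerProductSpace ℝ E] [FiniteDimensional ℝ E] {K : Set E} (hne : K.Nonempty)
    (hcomp : IsCompact K) (hconv : Convex ℝ K) {f : E → E → ℝ}
    (hcont : ∀ y ∈ K, ContinuousOn (fun x => f x y) K)
    (hconc : ∀ x ∈ K, ConcaveOn ℝ K (f x)) (hdiag : ∀ x ∈ K, f x x ≤ 0) :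
    ∃ x ∈ K, ∀ y ∈ K, f x y ≤ 0 := by
  by_contra! hcon
  obtain ⟨M, hM⟩ := hcomp.isBounded.subset_closedBall (0 : E)
  obtain ⟨c₀, hc₀⟩ := hne
  have hM0 : 0 ≤ M := (norm_nonneg c₀).trans (mem_closedBall_zero_iff.1 (hM hc₀))
  let t : E → Set E := fun x =>
    {v | v ∈ closedBall (0 : E) M ∧ (x ∈ K → v ∈ K ∧ 0 < f x v) ∧
      (‖x‖ ≤ M → v ∈ K) ∧ (M + 1 ≤ ‖x‖ → v = 0)}
  have htconv : ∀ x, Convex ℝ (t x) := by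
    intro x
    refine (convex_closedBall 0 M).inter (Convex.inter ?_ (Convex.inter ?_ ?_))
    · exact convex_setOf_imp fun hx => (hconc x hx).convex_gt 0
    · exact convex_setOf_imp fun _ => hconv
    · exact convex_setOf_imp fun _ => convex_singleton 0
  have hloc : ∀ x, ∃ c, ∀ᶠ y in 𝓝 x, c ∈ t y := by
    intro x
    rcases le_or_gt ‖x‖ M with hx | hx
    · have hnear : ∀ᶠ y in 𝓝 x, ‖y‖ < M + 1 :=
        continuous_norm.continuousAt.eventually_lt_const (by linarith)
      by_cases hxK : x ∈ K
      · obtain ⟨c, hc, hfc⟩ := hcon x hxK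
        refine ⟨c, ?_⟩
        have := eventually_nhdsWithin_iff.1 ((hcont c hc x hxK).eventually_const_lt hfc)
        filter_upwards [hnear, this] with y hy hy'
        exact ⟨hM hc, fun h => ⟨hc, hy' h⟩, fun _ => hc, fun h => absurd hy h.not_gt⟩
      · refine ⟨c₀, ?_⟩
        filter_upwards [hnear, hcomp.isClosed.isOpen_compl.mem_nhds hxK] with y hy hy'
        exact ⟨hM hc₀, fun h => absurd h hy', fun _ => hc₀, fun h => absurd hy h.not_gt⟩
    · refine ⟨0, ?_⟩
      filter_upwards [continuous_norm.continuousAt.eventually_const_lt hx] with y hy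
      exact ⟨by simpa using hM0, fun h => absurd (mem_closedBall_zero_iff.1 (hM h)) hy.not_ge,
        fun h => absurd h hy.not_ge, fun _ => rfl⟩
  obtain ⟨F, hF⟩ := exists_contMDiffMap_forall_mem_convex_of_local_const
    (n := 1) (modelWithCornersSelf ℝ E) htconv hloc
  have hFs : ContDiff ℝ 1 F := F.contMDiff.contDiff
  have hne : ∀ x, x - F x ≠ 0 := by
    intro x hx
    have hxF : x = F x := sub_eq_zero.1 hx
    obtain ⟨h1, h2, h3, -⟩ := hF x
    rw [← hxF] at h1 h2 h3
    have hxK := h3 (mem_closedBall_zero_iff.1 h1)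
    exact (h2 hxK).2.not_ge (hdiag x hxK)
  have hR : 0 < M + 1 := by linarith
  have hsub : ContDiff ℝ 1 fun x => x - F x := contDiff_id.sub hFs
  refine not_exists_contDiff_retraction (r := fun x => ((M + 1) / ‖x - F x‖) • (x - F x)) hR
    ((contDiff_const.div (hsub.norm ℝ hne) fun x => norm_ne_zero_iff.2 (hne x)).smul hsub)
    (fun x hx => ?_) fun x _ => ?_
  · simp [(hF x).2.2.2 hx.ge, hx, hR.ne']
  · rw [norm_smul, norm_div, norm_norm, div_mul_cancel₀ _ (norm_ne_zero_iff.2 (hne x)),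
      Real.norm_of_nonneg hR.le]

/-- **Rosen (1965), existence in concave games.** A strategic-form game with finitely many
players, nonempty compact convex strategy sets `S i ⊆ ℝ^{m i}`, utilities continuous on the
product of the strategy sets and concave in the player's own strategy, has at least one
pure-strategy Nash equilibrium. -/
theorem rosen_existence_concave_games
    {K : ℕ} (m : Fin K → ℕ)
    (S : ∀ i : Fin K, Set (EuclideanSpace ℝ (Fin (m i))))
    (u : ∀ _ : Fin K, (∀ j : Fin K, EuclideanSpace ℝ (Fin (m j))) → ℝ)
    (hne : ∀ i, (S i).Nonempty)
    (hcomp : ∀ i, IsCompact (S i))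
    (hconv : ∀ i, Convex ℝ (S i))
    (hcont : ∀ i, ContinuousOn (u i) (Set.univ.pi S))
    (hconc : ∀ i, ∀ s ∈ Set.univ.pi S,
      ConcaveOn ℝ (S i) (fun x => u i (Function.update s i x))) :
    ∃ s ∈ Set.univ.pi S, ∀ i, ∀ s' ∈ S i,
      u i (Function.update s i s') ≤ u i s := by
  let e := PiLp.continuousLinearEquiv 2 ℝ fun i => EuclideanSpace ℝ (Fin (m i))
  let P := e ⁻¹' univ.pi S
  have hupd : ∀ s ∈ univ.pi S, ∀ i, ∀ x ∈ S i, Function.update s i x ∈ univ.pi S := by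
    intro s hs i x hx j _
    rcases eq_or_ne j i with rfl | hj
    · simpa using hx
    · simpa [hj] using hs j trivial
  have hPcomp : IsCompact P := e.toHomeomorph.isCompact_preimage.2 (isCompact_univ_pi hcomp)
  have hPconv : Convex ℝ P :=
    (convex_pi fun i _ => hconv i).linear_preimage e.toLinearMap
  have hPne : P.Nonempty := (univ_pi_nonempty_iff.2 hne).preimage e.surjective
  obtain ⟨x, hx, hmax⟩ := exists_forall_le_zero_of_concaveOn hPne hPcomp hPconv
    (f := fun x y => ∑ i, (u i (Function.update (e x) i (e y i)) - u i (e x)))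
    (fun y hy => continuousOn_finsetSum _ fun i _ =>
      ((hcont i).comp (e.continuous.update i continuous_const).continuousOn
        fun x hx => hupd _ hx i _ (hy i trivial)).sub
        ((hcont i).comp e.continuous.continuousOn fun x hx => hx))
    (fun x hx => ⟨hPconv, fun y hy z hz a b ha hb hab => by
      simp only [Finset.smul_sum]
      rw [← Finset.sum_add_distrib]
      refine Finset.sum_le_sum fun i _ => ?_
      have := (hconc i _ hx).2 (hy i trivial) (hz i trivial) ha hb hab
      simp only [map_add, map_smul, Pi.add_apply, Pi.smul_apply, smul_eq_mul] at this ⊢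
      linear_combination this - (u i (e x)) * hab⟩)
    (fun x _ => by simp)
  refine ⟨e x, hx, fun i s' hs' => ?_⟩
  have h := hmax (e.symm (Function.update (e x) i s')) (hupd _ hx i s' hs')
  simp only [ContinuousLinearEquiv.apply_symm_apply] at h
  rw [Finset.sum_eq_single i (fun j _ hj => by simp [hj]) (by simp)] at h
  simpa using h
end

section
/- Lemma (standard functions have at most one fixed point). Let g : ℝ_{≥0}^K → ℝ_{>0}^K be a standard function: (monotonicity) for all x, x' ∈ ℝ_{≥0}^K with x ≤ x' componentwise, g(x) ≤ g(x') componentwise; and (scalability) for all α > 1 and all x ∈ ℝ_{≥0}^K, g(αx) < α g(x) componentwise (strict inequality in every component). Then g has at most one fixed point in ℝ_{≥0}^K. -/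
/-- A positive fixed point of a monotone scalable map dominates every nonnegative fixed point. -/
lemma fixed_point_le_of_monotone_of_scalable {ι : Type*} [Finite ι] {g : (ι → ℝ) → (ι → ℝ)}
    (hmono : ∀ x x' : ι → ℝ, (∀ i, 0 ≤ x i) → x ≤ x' → g x ≤ g x')
    (hscal : ∀ α : ℝ, 1 < α → ∀ x : ι → ℝ, (∀ i, 0 ≤ x i) → ∀ i, g (α • x) i < α * g x i)
    {x y : ι → ℝ} (hx : ∀ i, 0 < x i) (hy : ∀ i, 0 ≤ y i) (hgx : g x = x) (hgy : g y = y) :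
    y ≤ x := by
  by_contra h
  obtain ⟨j, hj⟩ : ∃ j, x j < y j := by simpa [Pi.le_def] using h
  have : Nonempty ι := ⟨j⟩
  obtain ⟨i, hi⟩ := Finite.exists_max fun k => y k / x k
  have hα : 1 < y i / x i := ((one_lt_div (hx j)).2 hj).trans_le (hi j)
  have hle : y ≤ (y i / x i) • x := fun k => by
    simpa using (div_le_iff₀ (hx k)).1 (hi k)
  have hlt := (hmono _ _ hy hle i).trans_lt (hscal _ hα x (fun k => (hx k).le) i)
  rw [hgx, hgy, div_mul_cancel₀ _ (hx i).ne'] at hlt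
  exact hlt.false

/-- **Standard functions have at most one fixed point (Yates, 1995).** If
`g : ℝ_{≥0}^K → ℝ_{>0}^K` is monotone (componentwise) and scalable
(`g (α • x) < α • g x` componentwise for every `α > 1`), then `g` has at most one
fixed point in the nonnegative orthant. -/
theorem standard_function_at_most_one_fixed_point
    {K : ℕ} (g : (Fin K → ℝ) → (Fin K → ℝ))
    (hpos : ∀ x : Fin K → ℝ, (∀ i, 0 ≤ x i) → ∀ i, 0 < g x i)
    (hmono : ∀ x x' : Fin K → ℝ, (∀ i, 0 ≤ x i) → x ≤ x' → g x ≤ g x')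
    (hscal : ∀ α : ℝ, 1 < α → ∀ x : Fin K → ℝ, (∀ i, 0 ≤ x i) →
      ∀ i, g (α • x) i < α * g x i) :
    ∀ x y : Fin K → ℝ, (∀ i, 0 ≤ x i) → (∀ i, 0 ≤ y i) →
      g x = x → g y = y → x = y := by
  intro x y hx hy hgx hgy
  have hx' : ∀ i, 0 < x i := fun i => by simpa only [hgx] using hpos x hx i
  have hy' : ∀ i, 0 < y i := fun i => by simpa only [hgy] using hpos y hy i
  exact le_antisymm (fixed_point_le_of_monotone_of_scalable hmono hscal hy' hx hgy hgx)
    (fixed_point_le_of_monotone_of_scalable hmono hscal hx' hy hgx hgy)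
end
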